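/- arXiv:2002.10078 — 2 statements merged into one kernel-verified Lean document; each statement's English description precedes it below -/
import Mathlib

section
/- Let n, m be positive integers, ε ∈ (0, 1/2), and z = ln((1−ε)/ε). For each i = 1,…,m let (a_i, b_i, c_i) be an ordered triple of pairwise distinct indices in {1,…,n}, and define x_{i,j} ∈ ℝⁿ for j = 1,2,3 as: zero except x_{i,1} is −z at a_i and z at b_i; x_{i,2} is −z at b_i and z at c_i; x_{i,3} is −z at c_i and z at a_i. Let w = (1,2,…,n). If a permutation π of {1,…,n} is such that for some index i₀ none of the conditions (I) π(a_{i₀}) < π(b_{i₀}) < π(c_{i₀}), (II) π(b_{i₀}) < π(c_{i₀}) < π(a_{i₀}), (III) π(c_{i₀}) < π(a_{i₀}) < π(b_{i₀}) holds, then (1/(3m))·Σ_{i=1}^m Σ_{j=1}^3 1/(1 + exp(w_πᵀx_{i,j})) ≥ (m+1)(1−ε)/(3m). -/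
theorem sum_mul_signed_indicator {ι : Type*} [Fintype ι] [DecidableEq ι] (v : ι → ℝ) (z : ℝ)
    {p q : ι} (hpq : p ≠ q) :
    ∑ l, v l * (if l = p then -z else if l = q then z else 0) = z * (v q - v p) := by
  have h : ∀ l, v l * (if l = p then -z else if l = q then z else 0)
      = (if l = p then -(v p * z) else 0) + (if l = q then v q * z else 0) := by
    intro l
    by_cases h₁ : l = p
    · subst h₁
      simp [hpq]
    · by_cases h₂ : l = q
      · subst h₂
        simp [h₁]
      · simp [h₁, h₂]
  simp only [h, Finset.sum_add_distrib, Finset.sum_ite_eq', Finset.mem_univ, if_true]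
  ring

theorem one_sub_le_logistic_log_odds {ε t : ℝ} (hε : ε ∈ Set.Ioo (0 : ℝ) (1 / 2))
    (ht : t ≤ -1) :
    1 - ε ≤ 1 / (1 + Real.exp (Real.log ((1 - ε) / ε) * t)) := by
  obtain ⟨h₀, h₁⟩ := hε
  have h₂ : 0 < 1 - ε := by linarith
  have hz : 0 ≤ Real.log ((1 - ε) / ε) :=
    Real.log_nonneg ((one_le_div h₀).2 (by linarith))
  have hexp : Real.exp (Real.log ((1 - ε) / ε) * t) ≤ ε / (1 - ε) := by
    calc Real.exp (Real.log ((1 - ε) / ε) * t)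
        ≤ Real.exp (-Real.log ((1 - ε) / ε)) := Real.exp_le_exp.2 (by nlinarith)
      _ = ε / (1 - ε) := by
        rw [Real.exp_neg, Real.exp_log (div_pos h₂ h₀), inv_div]
  rw [le_div_iff₀ (by positivity)]
  calc (1 - ε) * (1 + Real.exp (Real.log ((1 - ε) / ε) * t))
      ≤ (1 - ε) * (1 + ε / (1 - ε)) := by gcongr
    _ = 1 := by
      field_simp
      ring


/-- With `ε ∈ (0, 1/2)`, `z = ln((1-ε)/ε)`, `w = (1,2,…,n)`, and the
CYCLIC-ORDERING clause vectors `x i j` built from `z`: if for some index `i₀` a permutation `π`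
satisfies none of the three cyclic ordering conditions for `(a_{i₀}, b_{i₀}, c_{i₀})`, then the
average logistic loss `(1/(3m)) ∑ i ∑ j 1/(1 + exp(w_πᵀx_{i,j}))` is at least
`(m+1)(1-ε)/(3m)`. -/
theorem logistic_loss_ge_of_violated_triple (n m : ℕ) (hn : 0 < n) (hm : 0 < m)
    (ε : ℝ) (hε : ε ∈ Set.Ioo (0 : ℝ) (1 / 2)) (z : ℝ) (hz : z = Real.log ((1 - ε) / ε))
    (a b c : Fin m → Fin n)
    (habc : ∀ i : Fin m, a i ≠ b i ∧ b i ≠ c i ∧ c i ≠ a i)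
    (w : Fin n → ℝ) (hw : ∀ j : Fin n, w j = (j : ℕ) + 1)
    (x : Fin m → Fin 3 → Fin n → ℝ)
    (hx1 : ∀ i : Fin m, ∀ l : Fin n,
      x i 0 l = if l = a i then -z else if l = b i then z else 0)
    (hx2 : ∀ i : Fin m, ∀ l : Fin n,
      x i 1 l = if l = b i then -z else if l = c i then z else 0)
    (hx3 : ∀ i : Fin m, ∀ l : Fin n,
      x i 2 l = if l = c i then -z else if l = a i then z else 0)
    (π : Equiv.Perm (Fin n)) (i₀ : Fin m)
    (hπ : ¬ ((π (a i₀) < π (b i₀) ∧ π (b i₀) < π (c i₀)) ∨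
        (π (b i₀) < π (c i₀) ∧ π (c i₀) < π (a i₀)) ∨
        (π (c i₀) < π (a i₀) ∧ π (a i₀) < π (b i₀)))) :
    ((m : ℝ) + 1) * (1 - ε) / (3 * m) ≤
      (1 / (3 * m) : ℝ) * ∑ i, ∑ j : Fin 3,
        1 / (1 + Real.exp (∑ l, w (π l) * x i j l)) := by
  have h₂ : 0 < 1 - ε := by linarith [hε.2]
  have loss_nonneg : ∀ i j, 0 ≤ 1 / (1 + Real.exp (∑ l, w (π l) * x i j l)) :=
    fun i j => by positivity
  have loss_ge : ∀ i j (p q : Fin n), p ≠ q →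
      (∀ l, x i j l = if l = p then -z else if l = q then z else 0) → ¬ π p < π q →
      1 - ε ≤ 1 / (1 + Real.exp (∑ l, w (π l) * x i j l)) := by
    intro i j p q hpq hx hlt
    simp only [hx]
    rw [sum_mul_signed_indicator (fun l => w (π l)) z hpq, hz]
    apply one_sub_le_logistic_log_odds hε
    have hne : π p ≠ π q := π.injective.ne hpq
    have hle : ((π q : ℕ) : ℝ) + 1 ≤ (π p : ℕ) := by
      exact_mod_cast (show (π q : ℕ) + 1 ≤ (π p : ℕ) by omega)
    rw [hw, hw]
    linarith
  have loss₀ := fun i => loss_ge i 0 _ _ (habc i).1 (hx1 i)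
  have loss₁ := fun i => loss_ge i 1 _ _ (habc i).2.1 (hx2 i)
  have loss₂ := fun i => loss_ge i 2 _ _ (habc i).2.2 (hx3 i)
  have hterm : ∀ i, (1 - ε) + (if i = i₀ then 1 - ε else 0) ≤
      ∑ j : Fin 3, 1 / (1 + Real.exp (∑ l, w (π l) * x i j l)) := by
    intro i
    rw [Fin.sum_univ_three]
    have n₀ := loss_nonneg i 0
    have n₁ := loss_nonneg i 1
    have n₂ := loss_nonneg i 2
    have l₀ := loss₀ i
    have l₁ := loss₁ i
    have l₂ := loss₂ i
    by_cases hab : π (a i) < π (b i) <;> by_cases hbc : π (b i) < π (c i) <;>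
      by_cases hca : π (c i) < π (a i) <;>
      simp only [hab, hbc, hca, not_true_eq_false, not_false_eq_true, forall_const,
        false_imp_iff] at l₀ l₁ l₂ <;>
      by_cases hi : i = i₀ <;> simp only [hi, if_true, if_false] <;>
      first
        | (subst hi; linarith)
        | linarith
        | (exfalso; omega)
        | (exfalso; subst hi; simp [hab, hbc, hca] at hπ)
  have hsum : ((m : ℝ) + 1) * (1 - ε) ≤
      ∑ i, ∑ j : Fin 3, 1 / (1 + Real.exp (∑ l, w (π l) * x i j l)) := by
    refine le_trans (le_of_eq ?_) (Finset.sum_le_sum fun i _ => hterm i)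
    simp [Finset.sum_add_distrib]
    ring
  rw [div_eq_inv_mul, one_div]
  gcongr
end

section
/- Let n, m be positive integers, ε ∈ (0, 1/(3m+1)), and z = ln((1−ε)/ε). For each i = 1,…,m let (a_i, b_i, c_i) be an ordered triple of pairwise distinct indices in {1,…,n}, and define x_{i,j} ∈ ℝⁿ for j = 1,2,3 as: zero except x_{i,1} is −z at a_i and z at b_i; x_{i,2} is −z at b_i and z at c_i; x_{i,3} is −z at c_i and z at a_i. Let w = (1,2,…,n). Then there exists a permutation π of {1,…,n} with (1/(3m))·Σ_{i=1}^m Σ_{j=1}^3 1/(1 + exp(w_πᵀx_{i,j})) < (m+1)(1−ε)/(3m) if and only if there exists a permutation π of {1,…,n} such that for every i = 1,…,m one of the conditions (I) π(a_i) < π(b_i) < π(c_i), (II) π(b_i) < π(c_i) < π(a_i), (III) π(c_i) < π(a_i) < π(b_i) holds. -/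
theorem sum_mul_ite_ite_eq {ι R : Type*} [Fintype ι] [DecidableEq ι] [CommRing R] (f : ι → R)
    (z : R) {p q : ι} (hpq : p ≠ q) :
    ∑ l, f l * (if l = p then -z else if l = q then z else 0) = z * (f q - f p) := by
  have h : ∀ l, f l * (if l = p then -z else if l = q then z else 0) =
      (if l = q then f l * z else 0) - (if l = p then f l * z else 0) := by
    intro l
    by_cases h1 : l = p
    · have h2 : l ≠ q := fun h => hpq (h1.symm.trans h)
      simp [h1, hpq]
    · simp [h1]
  simp only [h, Finset.sum_sub_distrib, Finset.sum_ite_eq', Finset.mem_univ, if_true]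
  ring

theorem exp_log_odds {ε : ℝ} (h0 : 0 < ε) (h1 : ε < 1) :
    Real.exp (Real.log ((1 - ε) / ε)) = (1 - ε) / ε :=
  Real.exp_log (div_pos (by linarith) h0)

theorem log_odds_nonneg {ε : ℝ} (h0 : 0 < ε) (h1 : ε ≤ 1 / 2) :
    0 ≤ Real.log ((1 - ε) / ε) :=
  Real.log_nonneg ((one_le_div h0).2 (by linarith))

theorem logistic_loss_le {ε d : ℝ} (h0 : 0 < ε) (h1 : ε ≤ 1 / 2) (hd : 1 ≤ d) :
    1 / (1 + Real.exp (Real.log ((1 - ε) / ε) * d)) ≤ ε := by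
  have h := Real.exp_le_exp.2 (le_mul_of_one_le_right (log_odds_nonneg h0 h1) hd)
  rw [exp_log_odds h0 (by linarith), div_le_iff₀ h0] at h
  rw [div_le_iff₀ (by positivity)]
  linarith

theorem le_logistic_loss {ε d : ℝ} (h0 : 0 < ε) (h1 : ε ≤ 1 / 2) (hd : d ≤ -1) :
    1 - ε ≤ 1 / (1 + Real.exp (Real.log ((1 - ε) / ε) * d)) := by
  have hz := log_odds_nonneg h0 h1
  have h : Real.exp (Real.log ((1 - ε) / ε) * d) ≤ ε / (1 - ε) := by
    calc _ ≤ Real.exp (-Real.log ((1 - ε) / ε)) := Real.exp_le_exp.2 (by nlinarith)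
      _ = _ := by rw [Real.exp_neg, exp_log_odds h0 (by linarith), inv_div]
  rw [le_div_iff₀ (by linarith)] at h
  rw [le_div_iff₀ (by positivity)]
  linarith

theorem logistic_loss_nonneg (t : ℝ) : 0 ≤ 1 / (1 + Real.exp t) := by positivity

theorem logistic_loss_le_one (t : ℝ) : 1 / (1 + Real.exp t) ≤ 1 := by
  rw [div_le_one (by positivity)]
  linarith [Real.exp_pos t]

theorem Fin.cast_sub_cast_le_neg_one {n : ℕ} {p q : Fin n} (h : p < q) :
    ((p : ℕ) : ℝ) - ((q : ℕ) : ℝ) ≤ -1 := by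
  have : ((p : ℕ) : ℝ) + 1 ≤ ((q : ℕ) : ℝ) := by exact_mod_cast h
  linarith

theorem Fin.one_le_cast_sub_cast {n : ℕ} {p q : Fin n} (h : p < q) :
    1 ≤ ((q : ℕ) : ℝ) - ((p : ℕ) : ℝ) := by
  linarith [Fin.cast_sub_cast_le_neg_one h]

/-- The logistic loss of the example whose margin is the position of `q` minus that of `p`. -/
noncomputable def pairLoss {n : ℕ} (ε : ℝ) (p q : Fin n) : ℝ :=
  1 / (1 + Real.exp (Real.log ((1 - ε) / ε) * (((q : ℕ) : ℝ) - ((p : ℕ) : ℝ))))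

/-- The three cyclic orders of a triple that agree with `p < q < r`. -/
def IsCyclicallyOrdered {n : ℕ} (p q r : Fin n) : Prop :=
  (p < q ∧ q < r) ∨ (q < r ∧ r < p) ∨ (r < p ∧ p < q)

section

variable {n : ℕ} {ε : ℝ} {p q r : Fin n}

theorem pairLoss_le (h0 : 0 < ε) (h1 : ε ≤ 1 / 2) (h : p < q) : pairLoss ε p q ≤ ε :=
  logistic_loss_le h0 h1 (Fin.one_le_cast_sub_cast h)

theorem le_pairLoss (h0 : 0 < ε) (h1 : ε ≤ 1 / 2) (h : q < p) : 1 - ε ≤ pairLoss ε p q :=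
  le_logistic_loss h0 h1 (Fin.cast_sub_cast_le_neg_one h)

theorem pairLoss_nonneg : 0 ≤ pairLoss ε p q := logistic_loss_nonneg _

theorem pairLoss_le_one : pairLoss ε p q ≤ 1 := logistic_loss_le_one _

theorem IsCyclicallyOrdered.sum_pairLoss_le (h : IsCyclicallyOrdered p q r) (h0 : 0 < ε)
    (h1 : ε ≤ 1 / 2) : pairLoss ε p q + pairLoss ε q r + pairLoss ε r p ≤ 1 + 2 * ε := by
  rcases h with ⟨h, h'⟩ | ⟨h, h'⟩ | ⟨h, h'⟩
  · linarith [pairLoss_le h0 h1 h, pairLoss_le h0 h1 h', pairLoss_le_one (ε := ε) (p := r) (q := p)]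
  · linarith [pairLoss_le h0 h1 h, pairLoss_le h0 h1 h', pairLoss_le_one (ε := ε) (p := p) (q := q)]
  · linarith [pairLoss_le h0 h1 h, pairLoss_le h0 h1 h', pairLoss_le_one (ε := ε) (p := q) (q := r)]

theorem le_sum_pairLoss (hpq : p ≠ q) (h0 : 0 < ε) (h1 : ε ≤ 1 / 2) :
    1 - ε ≤ pairLoss ε p q + pairLoss ε q r + pairLoss ε r p := by
  have n1 := pairLoss_nonneg (ε := ε) (p := p) (q := q)
  have n2 := pairLoss_nonneg (ε := ε) (p := q) (q := r)
  have n3 := pairLoss_nonneg (ε := ε) (p := r) (q := p)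
  rcases lt_or_gt_of_ne hpq with h | h
  · rcases lt_or_ge p r with h' | h'
    · linarith [le_pairLoss h0 h1 h']
    · linarith [le_pairLoss h0 h1 (h'.trans_lt h)]
  · linarith [le_pairLoss h0 h1 h]

theorem le_sum_pairLoss_of_not_isCyclicallyOrdered (h : ¬ IsCyclicallyOrdered p q r)
    (hpq : p ≠ q) (hqr : q ≠ r) (hrp : r ≠ p) (h0 : 0 < ε) (h1 : ε ≤ 1 / 2) :
    2 * (1 - ε) ≤ pairLoss ε p q + pairLoss ε q r + pairLoss ε r p := by
  have n1 := pairLoss_nonneg (ε := ε) (p := p) (q := q)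
  have n2 := pairLoss_nonneg (ε := ε) (p := q) (q := r)
  have n3 := pairLoss_nonneg (ε := ε) (p := r) (q := p)
  unfold IsCyclicallyOrdered at h
  have key : (q < p ∧ r < q) ∨ (r < q ∧ p < r) ∨ (p < r ∧ q < p) := by omega
  rcases key with ⟨h, h'⟩ | ⟨h, h'⟩ | ⟨h, h'⟩ <;>
    linarith [le_pairLoss h0 h1 h, le_pairLoss h0 h1 h']

end

/-- The total loss is below `(m + 1) (1 - ε)` exactly when every triple is cyclically ordered. -/
theorem sum_pairLoss_lt_iff {n m : ℕ} {ε : ℝ} (h0 : 0 < ε) (h1 : ε ≤ 1 / 2)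
    (hε : ε * (3 * m + 1) < 1) {p q r : Fin m → Fin n}
    (hpqr : ∀ i, p i ≠ q i ∧ q i ≠ r i ∧ r i ≠ p i) :
    ∑ i, (pairLoss ε (p i) (q i) + pairLoss ε (q i) (r i) + pairLoss ε (r i) (p i)) <
      ((m : ℝ) + 1) * (1 - ε) ↔ ∀ i, IsCyclicallyOrdered (p i) (q i) (r i) := by
  constructor
  · intro h
    by_contra! ⟨k, hk⟩
    have hle : ∑ i : Fin m, ((1 - ε) + if i = k then 1 - ε else 0) ≤
        ∑ i, (pairLoss ε (p i) (q i) + pairLoss ε (q i) (r i) + pairLoss ε (r i) (p i)) := by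
      refine Finset.sum_le_sum fun i _ => ?_
      obtain ⟨hpq, hqr, hrp⟩ := hpqr i
      split_ifs with hi
      · subst hi
        linarith [le_sum_pairLoss_of_not_isCyclicallyOrdered hk hpq hqr hrp h0 h1]
      · linarith [le_sum_pairLoss (r := r i) hpq h0 h1]
    simp only [Finset.sum_add_distrib, Finset.sum_ite_eq', Finset.mem_univ, if_true,
      Finset.sum_const, Finset.card_univ, Fintype.card_fin, nsmul_eq_mul] at hle h
    linarith
  · intro h
    calc _ ≤ ∑ _i : Fin m, (1 + 2 * ε) :=
          Finset.sum_le_sum fun i _ => (h i).sum_pairLoss_le h0 h1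
      _ = m * (1 + 2 * ε) := by simp [mul_add]
      _ < _ := by linarith


/-- Correctness of the CYCLIC-ORDERING reduction for the logistic loss: with
`ε ∈ (0, 1/(3m+1))` and `z = ln((1-ε)/ε)`, there exists a permutation `π` whose average
logistic loss `(1/(3m)) ∑ i ∑ j 1/(1 + exp(w_πᵀx_{i,j}))` is below `(m+1)(1-ε)/(3m)` iff there
exists a permutation `π` satisfying, for every `i`, one of the three cyclic ordering conditions
for `(aᵢ, bᵢ, cᵢ)`. -/
theorem exists_perm_logistic_loss_lt_iff_cyclic_ordering (n m : ℕ) (hn : 0 < n) (hm : 0 < m)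
    (ε : ℝ) (hε : ε ∈ Set.Ioo (0 : ℝ) (1 / (3 * m + 1)))
    (z : ℝ) (hz : z = Real.log ((1 - ε) / ε))
    (a b c : Fin m → Fin n)
    (habc : ∀ i : Fin m, a i ≠ b i ∧ b i ≠ c i ∧ c i ≠ a i)
    (w : Fin n → ℝ) (hw : ∀ j : Fin n, w j = (j : ℕ) + 1)
    (x : Fin m → Fin 3 → Fin n → ℝ)
    (hx1 : ∀ i : Fin m, ∀ l : Fin n,
      x i 0 l = if l = a i then -z else if l = b i then z else 0)
    (hx2 : ∀ i : Fin m, ∀ l : Fin n,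
      x i 1 l = if l = b i then -z else if l = c i then z else 0)
    (hx3 : ∀ i : Fin m, ∀ l : Fin n,
      x i 2 l = if l = c i then -z else if l = a i then z else 0) :
    (∃ π : Equiv.Perm (Fin n),
        (1 / (3 * m) : ℝ) * ∑ i, ∑ j : Fin 3,
          1 / (1 + Real.exp (∑ l, w (π l) * x i j l)) <
            ((m : ℝ) + 1) * (1 - ε) / (3 * m)) ↔
      (∃ π : Equiv.Perm (Fin n), ∀ i : Fin m,
        (π (a i) < π (b i) ∧ π (b i) < π (c i)) ∨
        (π (b i) < π (c i) ∧ π (c i) < π (a i)) ∨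
        (π (c i) < π (a i) ∧ π (a i) < π (b i))) := by
  obtain ⟨h0, h1⟩ := hε
  have hm1 : (1 : ℝ) ≤ m := by exact_mod_cast hm
  rw [lt_div_iff₀ (by positivity)] at h1
  have h2 : ε ≤ 1 / 2 := by nlinarith
  refine exists_congr fun π => ?_
  have hsum : ∀ i, ∑ j : Fin 3, 1 / (1 + Real.exp (∑ l, w (π l) * x i j l)) =
      pairLoss ε (π (a i)) (π (b i)) + pairLoss ε (π (b i)) (π (c i)) +
        pairLoss ε (π (c i)) (π (a i)) := by
    intro i
    obtain ⟨hab, hbc, hca⟩ := habc i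
    rw [Fin.sum_univ_three]
    simp only [hx1, hx2, hx3]
    rw [sum_mul_ite_ite_eq (fun l => w (π l)) z hab, sum_mul_ite_ite_eq (fun l => w (π l)) z hbc,
      sum_mul_ite_ite_eq (fun l => w (π l)) z hca]
    simp only [hw, hz, pairLoss, add_sub_add_right_eq_sub]
  simp only [hsum]
  rw [one_div_mul_eq_div, div_lt_div_iff_of_pos_right (by positivity)]
  exact sum_pairLoss_lt_iff h0 h2 h1 fun i => by simpa using habc i
end
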